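/- Let Ω ⊆ ℝ² be a nonempty open, connected and simply connected set, and let M : Ω → ℝ^{2×2} be a smooth symmetric matrix field (M_{12} = M_{21} pointwise) with div Div M = 0 on Ω. Then there exists a smooth vector field ψ = (ψ₁, ψ₂) : Ω → ℝ² such that M = symCurl ψ on Ω. (This is the potential-function characterization of the kernel of div Div used to represent the divergence-free part of the bending moment tensor.) -/

import Mathlib

/-- Partial derivative in direction `i` of a scalar field on `ℝ²`. -/
noncomputable def pd (i : Fin 2) (f : (Fin 2 → ℝ) → ℝ) (x : Fin 2 → ℝ) : ℝ :=
  fderiv ℝ f x (Pi.single i 1)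

/-- Scalar divergence of a vector field: div v = ∂v₁/∂ξ₁ + ∂v₂/∂ξ₂. -/
noncomputable def vecDiv (v : (Fin 2 → ℝ) → Fin 2 → ℝ) (x : Fin 2 → ℝ) : ℝ :=
  pd 0 (fun y => v y 0) x + pd 1 (fun y => v y 1) x

/-- Row-wise divergence of a 2×2 matrix field: (Div K)_i = ∂K_{i1}/∂ξ₁ + ∂K_{i2}/∂ξ₂. -/
noncomputable def matDiv (K : (Fin 2 → ℝ) → Fin 2 → Fin 2 → ℝ) (x : Fin 2 → ℝ) : Fin 2 → ℝ :=
  fun i => pd 0 (fun y => K y i 0) x + pd 1 (fun y => K y i 1) x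

/-- The composition div Div of a 2×2 matrix field. -/
noncomputable def divDiv (K : (Fin 2 → ℝ) → Fin 2 → Fin 2 → ℝ) (x : Fin 2 → ℝ) : ℝ :=
  vecDiv (matDiv K) x

/-- Matrix Curl of a vector field: row i is (∂ψ_i/∂ξ₂, −∂ψ_i/∂ξ₁). -/
noncomputable def curlMat (ψ : (Fin 2 → ℝ) → Fin 2 → ℝ) (y : Fin 2 → ℝ) : Fin 2 → Fin 2 → ℝ :=
  fun i j => if j = 0 then pd 1 (fun z => ψ z i) y else -(pd 0 (fun z => ψ z i) y)

/-- symCurl ψ = ½(Curl ψ + (Curl ψ)ᵀ). -/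
noncomputable def symCurl (ψ : (Fin 2 → ℝ) → Fin 2 → ℝ) (y : Fin 2 → ℝ) : Fin 2 → Fin 2 → ℝ :=
  fun i j => (curlMat ψ y i j + curlMat ψ y j i) / 2

section Helpers

open Set Topology Filter

/-- The reals with the discrete topology. -/
def DiscR : Type := ℝ

/-- The underlying real. -/
def DiscR.toR (v : DiscR) : ℝ := v

/-- Build from a real. -/
def DiscR.ofR (v : ℝ) : DiscR := v

instance : TopologicalSpace DiscR := ⊥
instance : DiscreteTopology DiscR := ⟨rfl⟩

theorem exists_primitive_of_symm {E : Type*} [NormedAddCommGroup E] [NormedSpace ℝ E]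
    {Ω : Set E} (hΩ : IsOpen Ω) (hsc : SimplyConnectedSpace Ω)
    (ω : E → E →L[ℝ] ℝ) (hω : DifferentiableOn ℝ ω Ω)
    (hsym : ∀ a ∈ Ω, ∀ x y, fderiv ℝ ω a x y = fderiv ℝ ω a y x) :
    ∃ f : E → ℝ, ∀ a ∈ Ω, HasFDerivAt f (ω a) a := by
  have hloc : ∀ i : Ω, ∃ r : ℝ, ∃ f : E → ℝ, 0 < r ∧ Metric.ball (i : E) r ⊆ Ω ∧
      ∀ a ∈ Metric.ball (i : E) r, HasFDerivAt f (ω a) a := by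
    intro i
    obtain ⟨r, hr, hsub⟩ := Metric.isOpen_iff.mp hΩ i i.2
    obtain ⟨f, hf⟩ := (convex_ball (i : E) r).exists_forall_hasFDerivAt_of_fderiv_symmetric
      Metric.isOpen_ball (hω.mono hsub) (fun a ha => hsym a (hsub ha))
    exact ⟨r, f, hr, hsub, hf⟩
  choose r f hr hsub hf using hloc
  have hlc : ∀ i j : Ω, ∀ x ∈ Metric.ball (i : E) (r i) ∩ Metric.ball (j : E) (r j),
      ∀ᶠ y in 𝓝 x, f i y - f j y = f i x - f j x := by
    intro i j x hx
    have ho : IsOpen (Metric.ball (i : E) (r i) ∩ Metric.ball (j : E) (r j)) :=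
      Metric.isOpen_ball.inter Metric.isOpen_ball
    have hd : ∀ y ∈ Metric.ball (i : E) (r i) ∩ Metric.ball (j : E) (r j),
        HasFDerivAt (𝕜 := ℝ) (fun y => f i y - f j y) (0 : E →L[ℝ] ℝ) y := by
      intro y hy
      have h3 := (hf i y hy.1).sub (hf j y hy.2)
      rw [sub_self] at h3
      exact h3
    have := ho.isOpen_inter_preimage_of_fderiv_eq_zero (𝕜 := ℝ) (f := fun y => f i y - f j y)
      (fun y hy => (hd y hy).differentiableAt.differentiableWithinAt)
      (fun y hy => (hd y hy).fderiv) {f i x - f j x}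
    filter_upwards [this.mem_nhds ⟨hx, rfl⟩] with y hy using hy.2
  let Z : FiberBundleCore Ω Ω DiscR :=
    { baseSet := fun i => {x : Ω | (x : E) ∈ Metric.ball (i : E) (r i)}
      isOpen_baseSet := fun i => Metric.isOpen_ball.preimage continuous_subtype_val
      indexAt := fun x => x
      mem_baseSet_at := fun x => Metric.mem_ball_self (hr x)
      coordChange := fun i j x v => DiscR.ofR (v.toR + (f i x - f j x))
      coordChange_self := by
        intro i x _ v
        change v.toR + (f i x - f i x) = v.toR
        ring
      continuousOn_coordChange := by
        intro i j
        rintro ⟨x, v⟩ hx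
        apply ContinuousAt.continuousWithinAt
        have h1 : ∀ᶠ p : Ω × DiscR in 𝓝 (x, v),
            f i p.1 - f j p.1 = f i x - f j x :=
          (show ContinuousAt (fun p : Ω × DiscR => (p.1 : E)) (x, v) by fun_prop).eventually
            (hlc i j x hx.1)
        have h2 : ∀ᶠ p : Ω × DiscR in 𝓝 (x, v), p.2 = v :=
          (show ContinuousAt (fun p : Ω × DiscR => p.2) (x, v) by fun_prop).eventually
            ((isOpen_discrete ({v} : Set DiscR)).mem_nhds rfl)
        apply ContinuousAt.congr (f := fun _ => DiscR.ofR (v.toR + (f i x - f j x)))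
          continuousAt_const
        filter_upwards [h1, h2] with p hp1 hp2
        rw [hp1, hp2]
      coordChange_comp := by
        intro i j k x _ v
        change (v.toR + (f i x - f j x)) + (f j x - f k x) = v.toR + (f i x - f k x)
        ring }
  have cov : IsCoveringMap (Bundle.TotalSpace.proj : Bundle.TotalSpace DiscR Z.Fiber → Ω) :=
    FiberBundle.isCoveringMap
  have : LocallyPathConnectedSpace Ω := hΩ.locallyPathConnectedSpace
  have x₀ : Ω := Classical.choice (inferInstance : Nonempty Ω)
  obtain ⟨σ, ⟨-, hσ⟩, -⟩ := cov.existsUnique_continuousMap_lifts (ContinuousMap.id Ω) x₀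
    (⟨x₀, DiscR.ofR 0⟩ : Bundle.TotalSpace DiscR Z.Fiber) rfl
  have hσ' : ∀ x, (σ x).proj = x := fun x => congrFun hσ x
  let c : Ω → Ω → ℝ := fun i x => DiscR.toR (Z.localTriv i (σ x)).2
  have hc : ∀ i x, c i x = c x x + (f x x - f i x) := by
    intro i x
    have h1 : ∀ j, c j x =
        (DiscR.toR (σ x).snd + (f (σ x).proj (σ x).proj - f j (σ x).proj) : ℝ) := fun j => rfl
    rw [h1 i, h1 x, hσ' x]
    ring
  have hcl : ∀ i : Ω, ∀ᶠ x in 𝓝 i, c i x = c i i := by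
    intro i
    have hmem : σ i ∈ (Z.localTriv i).source := by
      change (σ i).proj ∈ Z.baseSet i
      rw [hσ' i]
      exact Z.mem_baseSet_at i
    have hcont : ContinuousAt (fun x => (Z.localTriv i (σ x)).2) i :=
      continuous_snd.continuousAt.comp
        (((Z.localTriv i).continuousAt hmem).comp σ.continuous.continuousAt)
    have h5 : ∀ᶠ x in 𝓝 i, (Z.localTriv i (σ x)).2 = (Z.localTriv i (σ i)).2 :=
      hcont.eventually
        ((isOpen_discrete ({(Z.localTriv i (σ i)).2} : Set DiscR)).mem_nhds rfl)
    exact h5.mono fun x hx => congrArg DiscR.toR hx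
  classical
  refine ⟨fun y => if h : y ∈ Ω then f ⟨y, h⟩ y + c ⟨y, h⟩ ⟨y, h⟩ else 0, fun a ha => ?_⟩
  have h1 := (hf ⟨a, ha⟩ a (Metric.mem_ball_self (hr _))).add_const (c ⟨a, ha⟩ ⟨a, ha⟩)
  apply h1.congr_of_eventuallyEq
  have h2 := hcl ⟨a, ha⟩
  rw [nhds_subtype_eq_comap, eventually_comap] at h2
  filter_upwards [h2, hΩ.mem_nhds ha] with y hy hyΩ
  have h3 := hy ⟨y, hyΩ⟩ rfl
  have h4 := hc ⟨a, ha⟩ ⟨y, hyΩ⟩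
  simp only [dif_pos hyΩ]
  simp only at h4
  linarith

theorem clm_eq_pd (L : (Fin 2 → ℝ) →L[ℝ] ℝ) (u : Fin 2 → ℝ) :
    L u = u 0 * L (Pi.single 0 1) + u 1 * L (Pi.single 1 1) := by
  have : u = u 0 • (Pi.single 0 1 : Fin 2 → ℝ) + u 1 • (Pi.single 1 1 : Fin 2 → ℝ) := by
    ext i; fin_cases i <;> simp
  conv_lhs => rw [this]
  simp

theorem exists_stream {Ω : Set (Fin 2 → ℝ)} (hΩ : IsOpen Ω) (hsc : SimplyConnectedSpace Ω)
    (a b : (Fin 2 → ℝ) → ℝ) (ha : ContDiffOn ℝ (⊤ : ℕ∞) a Ω) (hb : ContDiffOn ℝ (⊤ : ℕ∞) b Ω)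
    (h : ∀ x ∈ Ω, pd 0 a x + pd 1 b x = 0) :
    ∃ g : (Fin 2 → ℝ) → ℝ, ContDiffOn ℝ (⊤ : ℕ∞) g Ω ∧
      ∀ x ∈ Ω, pd 1 g x = a x ∧ pd 0 g x = - b x := by
  let P : Fin 2 → (Fin 2 → ℝ) →L[ℝ] ℝ := fun i => ContinuousLinearMap.proj i
  let ω : (Fin 2 → ℝ) → (Fin 2 → ℝ) →L[ℝ] ℝ := fun x => a x • P 1 - b x • P 0
  have hω : ContDiffOn ℝ (⊤ : ℕ∞) ω Ω :=
    (ha.smul contDiffOn_const).sub (hb.smul contDiffOn_const)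
  have hne : ((⊤ : ℕ∞) : WithTop ℕ∞) ≠ 0 := by simp
  obtain ⟨g, hg⟩ := exists_primitive_of_symm hΩ hsc ω (hω.differentiableOn hne) (by
    intro x hx u v
    have hax := (ha.differentiableOn hne).differentiableAt (hΩ.mem_nhds hx)
    have hbx := (hb.differentiableOn hne).differentiableAt (hΩ.mem_nhds hx)
    have hd : HasFDerivAt ω ((fderiv ℝ a x).smulRight (P 1) - (fderiv ℝ b x).smulRight (P 0)) x :=
      (hax.hasFDerivAt.smul_const (P 1)).sub (hbx.hasFDerivAt.smul_const (P 0))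
    rw [hd.fderiv]
    have hx0 := h x hx
    simp only [pd] at hx0
    simp only [P, ContinuousLinearMap.sub_apply, ContinuousLinearMap.smulRight_apply,
      ContinuousLinearMap.smul_apply, ContinuousLinearMap.proj_apply, smul_eq_mul]
    rw [clm_eq_pd (fderiv ℝ a x) u, clm_eq_pd (fderiv ℝ a x) v,
      clm_eq_pd (fderiv ℝ b x) u, clm_eq_pd (fderiv ℝ b x) v]
    linear_combination (u 0 * v 1 - v 0 * u 1) * hx0)
  refine ⟨g, ?_, fun x hx => ?_⟩
  · rw [contDiffOn_infty_iff_fderiv_of_isOpen hΩ]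
    exact ⟨fun x hx => (hg x hx).differentiableAt.differentiableWithinAt,
      hω.congr fun x hx => (hg x hx).fderiv⟩
  · simp [pd, (hg x hx).fderiv, ω, P]

theorem contDiffOn_pd {Ω : Set (Fin 2 → ℝ)} (hΩ : IsOpen Ω) (i : Fin 2)
    {f : (Fin 2 → ℝ) → ℝ} (hf : ContDiffOn ℝ (⊤ : ℕ∞) f Ω) :
    ContDiffOn ℝ (⊤ : ℕ∞) (pd i f) Ω :=
  ((contDiffOn_infty_iff_fderiv_of_isOpen hΩ).1 hf).2.clm_apply contDiffOn_const

end Helpers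

/-- On a nonempty open, connected and simply connected set `Ω ⊆ ℝ²`, every smooth
symmetric matrix field `M` with div Div M = 0 on Ω is of the form M = symCurl ψ for some smooth
vector field ψ. -/
theorem exists_potential_of_divDiv_eq_zero (Ω : Set (Fin 2 → ℝ)) (hne : Ω.Nonempty)
    (hΩ : IsOpen Ω) (hconn : IsConnected Ω) (hsc : SimplyConnectedSpace Ω)
    (M : (Fin 2 → ℝ) → Fin 2 → Fin 2 → ℝ) (hM : ContDiffOn ℝ (⊤ : ℕ∞) M Ω)
    (hsymm : ∀ x ∈ Ω, M x 0 1 = M x 1 0)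
    (hdiv : ∀ x ∈ Ω, divDiv M x = 0) :
    ∃ ψ : (Fin 2 → ℝ) → Fin 2 → ℝ, ContDiffOn ℝ (⊤ : ℕ∞) ψ Ω ∧
      ∀ x ∈ Ω, M x = symCurl ψ x := by
  have hMij : ∀ i j, ContDiffOn ℝ (⊤ : ℕ∞) (fun y => M y i j) Ω := fun i j =>
    contDiffOn_pi.1 (contDiffOn_pi.1 hM i) j
  have hne' : ((⊤ : ℕ∞) : WithTop ℕ∞) ≠ 0 := by simp
  have hv : ∀ i, ContDiffOn ℝ (⊤ : ℕ∞) (fun y => matDiv M y i) Ω := fun i =>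
    (contDiffOn_pd hΩ 0 (hMij i 0)).add (contDiffOn_pd hΩ 1 (hMij i 1))
  obtain ⟨φ, hφ, hφ'⟩ := exists_stream hΩ hsc _ _ (hv 0) (hv 1) hdiv
  have hdφ : ∀ x ∈ Ω, DifferentiableAt ℝ φ x := fun x hx =>
    (hφ.differentiableOn hne').differentiableAt (hΩ.mem_nhds hx)
  have hdM : ∀ i j, ∀ x ∈ Ω, DifferentiableAt ℝ (fun y => M y i j) x := fun i j x hx =>
    ((hMij i j).differentiableOn hne').differentiableAt (hΩ.mem_nhds hx)
  obtain ⟨ψ₀, hψ₀, h₀⟩ := exists_stream hΩ hsc (fun y => M y 0 0) (fun y => M y 0 1 - φ y)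
    (hMij 0 0) ((hMij 0 1).sub hφ) (by
      intro x hx
      have h1 := (hφ' x hx).1
      simp only [matDiv, pd] at h1 ⊢
      rw [fderiv_fun_sub (hdM 0 1 x hx) (hdφ x hx), ContinuousLinearMap.sub_apply]
      linarith)
  obtain ⟨ψ₁, hψ₁, h₁⟩ := exists_stream hΩ hsc (fun y => M y 1 0 + φ y) (fun y => M y 1 1)
    ((hMij 1 0).add hφ) (hMij 1 1) (by
      intro x hx
      have h1 := (hφ' x hx).2
      simp only [matDiv, pd] at h1 ⊢
      rw [fderiv_fun_add (hdM 1 0 x hx) (hdφ x hx), ContinuousLinearMap.add_apply]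
      linarith)
  refine ⟨fun x => ![ψ₀ x, ψ₁ x], ?_, fun x hx => ?_⟩
  · rw [contDiffOn_pi]
    intro i
    fin_cases i
    · exact hψ₀
    · exact hψ₁
  · have e0 := h₀ x hx
    have e1 := h₁ x hx
    have hs := hsymm x hx
    ext i j
    fin_cases i <;> fin_cases j <;> simp [symCurl, curlMat, e0.1, e0.2, e1.1, e1.2] <;> linarith
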